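/- A power series Σ a_n xⁿ ∈ ℚ[[x]] whose coefficients satisfy a_n ~ κ·ρⁿ/n as n → ∞ for some κ > 0 and ρ > 1 (i.e., n·a_n/ρⁿ → κ) cannot satisfy a polynomial equation P(x, f(x)) = 0 with P ∈ ℚ[x,y] nonzero; in particular, such a series is transcendental over ℚ(x). -/

import Mathlib

open Filter Polynomial

/-- The power series `φ` converges absolutely at the real point `x`, with sum `v`. -/
def HasRealSum (φ : PowerSeries ℚ) (x v : ℝ) : Prop :=
  Summable (fun n => ‖((PowerSeries.coeff n φ : ℚ) : ℝ) * x ^ n‖) ∧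
    HasSum (fun n => ((PowerSeries.coeff n φ : ℚ) : ℝ) * x ^ n) v

namespace HasRealSum

variable {φ ψ : PowerSeries ℚ} {x v w : ℝ}

lemma add (hφ : HasRealSum φ x v) (hψ : HasRealSum ψ x w) : HasRealSum (φ + ψ) x (v + w) := by
  have e : (fun n => ((PowerSeries.coeff n (φ + ψ) : ℚ) : ℝ) * x ^ n) =
      fun n => ((PowerSeries.coeff n φ : ℚ) : ℝ) * x ^ n +
        ((PowerSeries.coeff n ψ : ℚ) : ℝ) * x ^ n := by
    ext n
    simp [add_mul]
  refine ⟨?_, e ▸ hφ.2.add hψ.2⟩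
  exact (e ▸ hφ.2.summable.add hψ.2.summable :
    Summable fun n => ((PowerSeries.coeff n (φ + ψ) : ℚ) : ℝ) * x ^ n).norm

lemma mul (hφ : HasRealSum φ x v) (hψ : HasRealSum ψ x w) : HasRealSum (φ * ψ) x (v * w) := by
  have e : (fun n => ((PowerSeries.coeff n (φ * ψ) : ℚ) : ℝ) * x ^ n) =
      fun n => ∑ kl ∈ Finset.HasAntidiagonal.antidiagonal n,
        (((PowerSeries.coeff kl.1 φ : ℚ) : ℝ) * x ^ kl.1) *
          (((PowerSeries.coeff kl.2 ψ : ℚ) : ℝ) * x ^ kl.2) := by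
    ext n
    rw [PowerSeries.coeff_mul, Rat.cast_sum, Finset.sum_mul]
    refine Finset.sum_congr rfl fun kl hkl => ?_
    rw [← Finset.HasAntidiagonal.mem_antidiagonal.1 hkl, pow_add]
    push_cast
    ring
  have hs := (summable_norm_sum_mul_antidiagonal_of_summable_norm hφ.1 hψ.1)
  have ht := tsum_mul_tsum_eq_tsum_sum_antidiagonal_of_summable_norm hφ.1 hψ.1
  rw [hφ.2.tsum_eq, hψ.2.tsum_eq] at ht
  refine ⟨by simpa only [← congrFun e] using hs, ?_⟩
  rw [e, ht]
  exact hs.of_norm.hasSum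

lemma coe (p : ℚ[X]) (x : ℝ) : HasRealSum p x (aeval x p) := by
  have h : ∀ n ∉ p.support, ((PowerSeries.coeff n (p : PowerSeries ℚ) : ℚ) : ℝ) * x ^ n = 0 := by
    intro n hn
    simp [notMem_support_iff.1 hn]
  refine ⟨(summable_of_ne_finset_zero h).norm, ?_⟩
  convert hasSum_sum_of_ne_finset_zero (L := .unconditional ℕ) h using 1
  rw [aeval_eq_sum_range, Finset.sum_subset p.supp_subset_range_natDegree_succ]
  · simp [Algebra.smul_def]
  · exact fun n _ hn => h n hn

lemma pow (hφ : HasRealSum φ x v) (n : ℕ) : HasRealSum (φ ^ n) x (v ^ n) := by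
  induction n with
  | zero => simpa using coe 1 x
  | succ n ih => simpa only [pow_succ] using ih.mul hφ

lemma eval₂ (hφ : HasRealSum φ x v) (P : ℚ[X][X]) :
    HasRealSum (P.eval₂ coeToPowerSeries.ringHom φ) x
      (P.eval₂ (aeval x : ℚ[X] →ₐ[ℚ] ℝ).toRingHom v) := by
  induction P using Polynomial.induction_on' with
  | add p q hp hq => simpa only [eval₂_add] using hp.add hq
  | monomial n p =>
    simp only [eval₂_monomial]
    exact (coe p x).mul (hφ.pow n)

end HasRealSum

/-- A nonzero bivariate polynomial is a power of `x - r` times one not vanishing identically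
on the line `x = r`. -/
lemma Polynomial.exists_eq_C_X_sub_C_pow_mul {P : ℝ[X][X]} (hP : P ≠ 0) (r : ℝ) :
    ∃ (k : ℕ) (Q : ℝ[X][X]), Q.map (evalRingHom r) ≠ 0 ∧ P = C ((X - C r) ^ k) * Q := by
  have hu : Irreducible (C (X - C r) : ℝ[X][X]) := (prime_C_iff.2 (prime_X_sub_C r)).irreducible
  obtain ⟨k, Q, hQ, h⟩ := WfDvdMonoid.max_power_factor hP hu
  refine ⟨k, Q, fun h0 => hQ (C_dvd_iff_dvd_coeff _ _ |>.2 fun j => ?_), by simpa using h⟩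
  rw [dvd_iff_isRoot]
  simpa using congrArg (coeff · j) h0

/-- A function tending to infinity slower than every power of `x - r` is not a root of a
bivariate polynomial that does not vanish identically on the line `x = r`. -/
lemma Polynomial.not_eventually_eval₂_eq_zero {l : Filter ℝ} [l.NeBot] {r : ℝ} {f : ℝ → ℝ}
    (hl : Tendsto id l (nhds r)) (hf : Tendsto f l atTop)
    (hslow : ∀ k : ℕ, Tendsto (fun x => (x - r) * f x ^ k) l (nhds 0))
    {Q : ℝ[X][X]} (hQ : Q.map (evalRingHom r) ≠ 0) :
    ¬ ∀ᶠ x in l, Q.eval₂ (evalRingHom x) (f x) = 0 := by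
  intro h
  set J := (Q.map (evalRingHom r)).natDegree with hJ
  have hJ0 : (Q.coeff J).eval r ≠ 0 := by
    rw [← coe_evalRingHom, ← coeff_map]
    exact leadingCoeff_ne_zero.2 hQ
  have hJhigh : ∀ j, J < j → (Q.coeff j).eval r = 0 := fun j hj => by
    simpa using coeff_eq_zero_of_natDegree_lt hj
  have hcont : ∀ p : ℝ[X], Tendsto (fun x => p.eval x) l (nhds (p.eval r)) := fun p =>
    (p.continuous.tendsto r).comp hl
  have hterm : ∀ j, Tendsto (fun x => (Q.coeff j).eval x * (f x ^ j / f x ^ J)) l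
      (nhds (if j = J then (Q.coeff J).eval r else 0)) := by
    intro j
    rcases lt_trichotomy j J with hj | rfl | hj
    · rw [if_neg hj.ne]
      have := ((tendsto_pow_div_pow_atTop_zero (𝕜 := ℝ) hj).comp hf)
      simpa using (hcont (Q.coeff j)).mul this
    · rw [if_pos rfl]
      refine (hcont _).congr' ?_
      filter_upwards [hf.eventually_gt_atTop 0] with x hx
      rw [div_self (by positivity), mul_one]
    · rw [if_neg hj.ne']
      obtain ⟨p, hp⟩ := dvd_iff_isRoot.2 (hJhigh j hj)
      have := (hcont p).mul (hslow (j - J))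
      rw [mul_zero] at this
      refine this.congr' ?_
      filter_upwards [hf.eventually_gt_atTop 0] with x hx
      rw [pow_sub₀ _ hx.ne' hj.le, hp]
      simp only [eval_mul, eval_sub, eval_X, eval_C]
      ring
  have hsum := tendsto_finsetSum (Finset.range (Q.natDegree + 1)) fun j _ => hterm j
  have hJmem : J ∈ Finset.range (Q.natDegree + 1) :=
    Finset.mem_range.2 (Nat.lt_succ_of_le natDegree_map_le)
  rw [Finset.sum_ite_eq' _ J, if_pos hJmem] at hsum
  refine hJ0 (tendsto_nhds_unique hsum (tendsto_const_nhds.congr' ?_))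
  filter_upwards [h] with x hx
  rw [eval₂_eq_sum_range] at hx
  simp only [← mul_div_assoc, ← Finset.sum_div]
  simp only [coe_evalRingHom] at hx
  rw [hx, zero_div]

lemma hasSum_pow_div_log {t : ℝ} (h0 : 0 ≤ t) (h1 : t < 1) :
    HasSum (fun n : ℕ => (n : ℝ)⁻¹ * t ^ n) (-Real.log (1 - t)) := by
  have := Real.hasSum_pow_div_log_of_abs_lt_one (abs_lt.2 ⟨by linarith, h1⟩)
  rw [← hasSum_nat_add_iff' 1]
  simpa [div_eq_inv_mul] using this

lemma tsum_mul_pow_le_add {b d : ℕ → ℝ} {N : ℕ} (hbd : ∀ n ≥ N, b n ≤ d n) {t : ℝ}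
    (h0 : 0 ≤ t) (h1 : t ≤ 1) (hb : Summable fun n => b n * t ^ n)
    (hd : Summable fun n => d n * t ^ n) :
    ∑' n, b n * t ^ n ≤ ∑' n, d n * t ^ n + ∑ n ∈ Finset.range N, |b n - d n| := by
  have hs : HasSum (fun n => if n < N then |b n - d n| else 0)
      (∑ n ∈ Finset.range N, |b n - d n|) := by
    have := hasSum_sum_of_ne_finset_zero (f := fun n => if n < N then |b n - d n| else 0)
      (L := .unconditional ℕ)
      (s := Finset.range N) fun n hn => if_neg (by simpa using hn)
    rwa [Finset.sum_congr rfl fun n hn => if_pos (Finset.mem_range.1 hn)] at this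
  rw [← hs.tsum_eq, ← hd.tsum_add hs.summable]
  refine hb.tsum_le_tsum (fun n => ?_) (hd.add hs.summable)
  split_ifs with hn
  · have hp : t ^ n ≤ 1 := pow_le_one₀ h0 h1
    have hq : (0 : ℝ) ≤ t ^ n := by positivity
    nlinarith [le_abs_self (b n - d n), abs_nonneg (b n - d n),
      mul_le_mul_of_nonneg_right (le_abs_self (b n - d n)) hq]
  · rw [add_zero]
    exact mul_le_mul_of_nonneg_right (hbd n (not_lt.1 hn)) (by positivity)

/-- If `n * b n` tends to a positive limit, then `∑ b n * t ^ n` converges absolutely on `[0, 1)`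
and is comparable to `-log (1 - t)`. -/
lemma exists_log_bounds {b : ℕ → ℝ} {κ : ℝ} (hκ : 0 < κ)
    (hb : Tendsto (fun n : ℕ => (n : ℝ) * b n) atTop (nhds κ)) :
    ∃ B : ℝ, ∀ t : ℝ, 0 ≤ t → t < 1 → Summable (fun n => b n * t ^ n) ∧
      κ / 2 * -Real.log (1 - t) - B ≤ ∑' n, b n * t ^ n ∧
      ∑' n, b n * t ^ n ≤ 2 * κ * -Real.log (1 - t) + B := by
  obtain ⟨N, hN⟩ := eventually_atTop.1 ((hb.eventually_lt_const (by linarith : κ < 2 * κ)).and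
    ((hb.eventually_const_lt (by linarith : κ / 2 < κ)).and (eventually_gt_atTop 0)))
  have hup : ∀ n ≥ N, b n ≤ 2 * κ * (n : ℝ)⁻¹ := fun n hn => by
    obtain ⟨h1, -, h3⟩ := hN n hn
    have : (0 : ℝ) < n := Nat.cast_pos.2 h3
    rw [← div_eq_mul_inv, le_div_iff₀ this]
    linarith
  have hlo : ∀ n ≥ N, κ / 2 * (n : ℝ)⁻¹ ≤ b n := fun n hn => by
    obtain ⟨-, h2, h3⟩ := hN n hn
    have : (0 : ℝ) < n := Nat.cast_pos.2 h3
    rw [← div_eq_mul_inv, div_le_iff₀ this]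
    linarith
  refine ⟨∑ n ∈ Finset.range N, |κ / 2 * (n : ℝ)⁻¹ - b n| +
    ∑ n ∈ Finset.range N, |b n - 2 * κ * (n : ℝ)⁻¹|, fun t h0 h1 => ?_⟩
  have hlog (c : ℝ) : HasSum (fun n : ℕ => c * (n : ℝ)⁻¹ * t ^ n) (c * -Real.log (1 - t)) := by
    simpa only [mul_assoc] using (hasSum_pow_div_log h0 h1).mul_left c
  have hs : Summable (fun n => b n * t ^ n) := by
    refine Summable.of_norm_bounded_eventually_nat (hlog (2 * κ)).summable ?_
    filter_upwards [eventually_ge_atTop N] with n hn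
    have hb0 : 0 ≤ b n := le_trans (by positivity) (hlo n hn)
    rw [Real.norm_of_nonneg (by positivity)]
    exact mul_le_mul_of_nonneg_right (hup n hn) (by positivity)
  have hA := tsum_mul_pow_le_add hlo h0 h1.le (hlog _).summable hs
  have hB := tsum_mul_pow_le_add hup h0 h1.le hs (hlog _).summable
  rw [(hlog _).tsum_eq] at hA hB
  have hA0 : 0 ≤ ∑ n ∈ Finset.range N, |κ / 2 * (n : ℝ)⁻¹ - b n| :=
    Finset.sum_nonneg fun _ _ => abs_nonneg _
  have hB0 : 0 ≤ ∑ n ∈ Finset.range N, |b n - 2 * κ * (n : ℝ)⁻¹| :=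
    Finset.sum_nonneg fun _ _ => abs_nonneg _
  exact ⟨hs, by linarith, by linarith⟩

/-- A power series `Σ aₙ xⁿ ∈ ℚ[[x]]` whose coefficients satisfy `aₙ ~ κ·ρⁿ/n`
for some `κ > 0` and `ρ > 1` is transcendental over `ℚ(x)`: it satisfies no
nonzero polynomial equation `P(x, f(x)) = 0` with `P ∈ ℚ[x][y]`. -/
theorem transcendence_from_asymptotics (a : ℕ → ℚ) (κ ρ : ℝ)
    (hκ : 0 < κ) (hρ : 1 < ρ)
    (hasymp : Tendsto (fun n : ℕ => (n : ℝ) * (a n : ℝ) / ρ ^ n) atTop (nhds κ)) :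
    ¬ ∃ P : Polynomial (Polynomial ℚ), P ≠ 0 ∧
        Polynomial.eval₂ Polynomial.coeToPowerSeries.ringHom
          (PowerSeries.mk a) P = 0 := by
  rintro ⟨P, hP, hPa⟩
  have hρ0 : 0 < ρ := by linarith
  obtain ⟨B, hB⟩ := exists_log_bounds (b := fun n => (a n : ℝ) / ρ ^ n) hκ
    (by simpa only [mul_div_assoc] using hasymp)
  set r := ρ⁻¹ with hr
  have hr0 : 0 < r := inv_pos.2 hρ0
  have hρr : ρ * r = 1 := mul_inv_cancel₀ hρ0.ne'
  let f : ℝ → ℝ := fun x => ∑' n, (a n : ℝ) * x ^ n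
  let L : ℝ → ℝ := fun x => -Real.log (1 - ρ * x)
  let l := nhdsWithin r (Set.Iio r)
  have hnear : ∀ᶠ x in l, 0 < x ∧ x < r :=
    (eventually_nhdsWithin_of_eventually_nhds (eventually_gt_nhds hr0)).and
      self_mem_nhdsWithin
  have hbound : ∀ᶠ x in l, Summable (fun n => (a n : ℝ) * x ^ n) ∧
      κ / 2 * L x - B ≤ f x ∧ f x ≤ 2 * κ * L x + B := by
    filter_upwards [hnear] with x hx
    have e : ∀ n, (a n : ℝ) / ρ ^ n * (ρ * x) ^ n = a n * x ^ n := fun n => by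
      rw [mul_pow]
      field_simp
    simpa only [e] using hB (ρ * x) (mul_pos hρ0 hx.1).le
      (by rw [← hρr]; exact mul_lt_mul_of_pos_left hx.2 hρ0)
  have hl : Tendsto id l (nhds r) := nhdsWithin_le_nhds
  have hL : Tendsto L l atTop := by
    refine tendsto_neg_atBot_atTop.comp (Real.tendsto_log_nhdsGT_zero.comp ?_)
    refine tendsto_nhdsWithin_iff.2 ⟨?_, ?_⟩
    · have := (hl.const_mul ρ).const_sub 1
      rwa [hρr, sub_self] at this
    · filter_upwards [hnear] with x hx
      have := mul_lt_mul_of_pos_left hx.2 hρ0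
      exact sub_pos.2 (hρr ▸ this)
  have hf : Tendsto f l atTop := by
    refine tendsto_atTop_mono' l (hbound.mono fun x hx => hx.2.1) ?_
    exact tendsto_atTop_add_const_right _ _ (hL.const_mul_atTop (by positivity))
  have hslow : ∀ k : ℕ, Tendsto (fun x => (x - r) * f x ^ k) l (nhds 0) := by
    intro k
    have h := (((Real.tendsto_pow_mul_exp_neg_atTop_nhds_zero k).comp hL).const_mul
      (r * (2 * κ + 1) ^ k))
    rw [mul_zero] at h
    refine squeeze_zero_norm' ?_ h
    filter_upwards [hnear, hbound, hL.eventually_ge_atTop B, hf.eventually_ge_atTop 0]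
      with x hx hb hLB hf0
    have hu : 0 < 1 - ρ * x := by
      have := mul_lt_mul_of_pos_left hx.2 hρ0
      exact sub_pos.2 (hρr ▸ this)
    have hexp : Real.exp (-L x) = 1 - ρ * x := by
      simp only [L, neg_neg, Real.exp_log hu]
    have hfk : f x ^ k ≤ (2 * κ + 1) ^ k * L x ^ k := by
      rw [← mul_pow]
      exact pow_le_pow_left₀ hf0 (by linarith [hb.2.2]) k
    rw [Real.norm_eq_abs, abs_mul, abs_of_neg (sub_neg.2 hx.2), abs_of_nonneg (by positivity)]
    have hrx : -(x - r) = r * (1 - ρ * x) := by linear_combination x * hρr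
    rw [hrx]
    calc r * (1 - ρ * x) * f x ^ k ≤ r * (1 - ρ * x) * ((2 * κ + 1) ^ k * L x ^ k) := by gcongr
      _ = _ := by simp only [Function.comp, hexp]; ring
  let φ := algebraMap ℚ ℝ
  have hP' : P.map (mapRingHom φ) ≠ 0 :=
    (Polynomial.map_ne_zero_iff (map_injective φ φ.injective)).2 hP
  obtain ⟨k, Q, hQ, hPQ⟩ := exists_eq_C_X_sub_C_pow_mul hP' r
  refine not_eventually_eval₂_eq_zero hl hf hslow hQ ?_
  filter_upwards [hnear, hbound] with x hx hb
  have hsum : HasRealSum (PowerSeries.mk a) x (f x) := by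
    constructor
    · simpa only [PowerSeries.coeff_mk] using hb.1.norm
    · simpa only [PowerSeries.coeff_mk] using hb.1.hasSum
  have hzero : P.eval₂ (aeval x : ℚ[X] →ₐ[ℚ] ℝ).toRingHom (f x) = 0 := by
    have h := (hsum.eval₂ P).2
    rw [hPa] at h
    exact h.unique (by simp)
  have hcomp : (evalRingHom x).comp (mapRingHom φ) = (aeval x : ℚ[X] →ₐ[ℚ] ℝ).toRingHom := by
    ext <;> simp
  rw [← hcomp, ← eval₂_map, hPQ, eval₂_mul, eval₂_C, coe_evalRingHom] at hzero
  refine (mul_eq_zero.1 hzero).resolve_left ?_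
  simpa using fun h : x - r = 0 => absurd hx.2 (by linarith)
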